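/- (Trichotomy for distant connected sets, used in the proof of Lemma 4.5.) Let m ≥ 2 and let M_1, M_2 be nonempty finite connected subsets of ℤ^m with d(M_1, M_2) > 1 (with respect to the ℓ∞ metric). Then at least one of the following holds: (a) M_2 ∪ Int M_2 ⊆ Int M_1; (b) M_1 ∪ Int M_1 ⊆ Int M_2; (c) the sets M_1 ∪ Int M_1 and M_2 ∪ Int M_2 are disjoint. -/

import Mathlib

/-- ℓ∞ adjacency on `ℤ^m`: distinct points at `ℓ∞` distance at most `1`. -/
def Adj {m : ℕ} (x y : Fin m → ℤ) : Prop := x ≠ y ∧ ∀ k, |x k - y k| ≤ 1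

/-- One step of a chain inside `B`: adjacent points both lying in `B`. -/
def Step {m : ℕ} (B : Set (Fin m → ℤ)) (p q : Fin m → ℤ) : Prop :=
  Adj p q ∧ p ∈ B ∧ q ∈ B

/-- The connected component of `x` inside `B` (points reachable from `x` by chains in `B`). -/
def component {m : ℕ} (B : Set (Fin m → ℤ)) (x : Fin m → ℤ) : Set (Fin m → ℤ) :=
  {y | Relation.ReflTransGen (Step B) x y}

/-- A set is connected if any two of its points are joined by a chain inside it. -/
def ConnectedIn {m : ℕ} (B : Set (Fin m → ℤ)) : Prop :=
  ∀ x ∈ B, ∀ y ∈ B, Relation.ReflTransGen (Step B) x y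

/-- Two sets are distant if every pair of points, one from each, is at `ℓ∞` distance `> 1`. -/
def Distant {m : ℕ} (K L : Set (Fin m → ℤ)) : Prop :=
  ∀ x ∈ K, ∀ y ∈ L, ∃ k, 1 < |x k - y k|

/-- `Int M`: the union of all finite connected components of the complement of `M`. -/
def interior' {m : ℕ} (M : Set (Fin m → ℤ)) : Set (Fin m → ℤ) :=
  {y | ∃ x, x ∉ M ∧ (component Mᶜ x).Finite ∧ y ∈ component Mᶜ x}

section

variable {m : ℕ}

theorem Adj.symm {x y : Fin m → ℤ} (h : Adj x y) : Adj y x :=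
  ⟨h.1.symm, fun k => abs_sub_comm (x k) (y k) ▸ h.2 k⟩

theorem Step.symm {B : Set (Fin m → ℤ)} {x y : Fin m → ℤ} (h : Step B x y) : Step B y x :=
  ⟨h.1.symm, h.2.2, h.2.1⟩

theorem mem_component_self (B : Set (Fin m → ℤ)) (x : Fin m → ℤ) : x ∈ component B x :=
  Relation.ReflTransGen.refl

theorem mem_component_comm {B : Set (Fin m → ℤ)} {x y : Fin m → ℤ} :
    y ∈ component B x ↔ x ∈ component B y := by
  have : Std.Symm (Step B) := ⟨fun _ _ h => h.symm⟩
  exact ⟨fun h => Std.Symm.symm (r := Relation.ReflTransGen (Step B)) _ _ h,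
    fun h => Std.Symm.symm (r := Relation.ReflTransGen (Step B)) _ _ h⟩

theorem component_eq_of_mem {B : Set (Fin m → ℤ)} {x y : Fin m → ℤ}
    (h : y ∈ component B x) : component B y = component B x := by
  ext z
  exact ⟨fun hz => Relation.ReflTransGen.trans h hz,
    fun hz => Relation.ReflTransGen.trans (mem_component_comm.1 h) hz⟩

theorem component_subset {B : Set (Fin m → ℤ)} {x : Fin m → ℤ} (hx : x ∈ B) :
    component B x ⊆ B := by
  intro y hy
  rcases Relation.ReflTransGen.cases_tail hy with rfl | ⟨_, _, h⟩
  exacts [hx, h.2.2]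

theorem component_subset_component {B B' : Set (Fin m → ℤ)} {x : Fin m → ℤ}
    (h : component B x ⊆ B') : component B x ⊆ component B' x := by
  intro y hy
  induction hy with
  | refl => exact mem_component_self B' x
  | tail hb hs ih => exact ih.tail ⟨hs.1, h hb, h (hb.tail hs)⟩

theorem ConnectedIn.mem_component {S B : Set (Fin m → ℤ)} (hS : ConnectedIn S) (hSB : S ⊆ B)
    {x y : Fin m → ℤ} (hx : x ∈ S) (hy : y ∈ S) : y ∈ component B x :=
  Relation.ReflTransGen.mono (fun _ _ h => ⟨h.1, hSB h.2.1, hSB h.2.2⟩) _ _ (hS x hx y hy)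

theorem mem_interior'_iff {M : Set (Fin m → ℤ)} {y : Fin m → ℤ} :
    y ∈ interior' M ↔ y ∉ M ∧ (component Mᶜ y).Finite := by
  constructor
  · rintro ⟨x, hx, hfin, hy⟩
    exact ⟨component_subset hx hy, component_eq_of_mem hy ▸ hfin⟩
  · rintro ⟨hy, hfin⟩
    exact ⟨y, hy, hfin, mem_component_self _ y⟩

theorem component_subset_interior' {M : Set (Fin m → ℤ)} {y : Fin m → ℤ}
    (hy : y ∈ interior' M) : component Mᶜ y ⊆ interior' M := fun _ hz =>
  ⟨y, (mem_interior'_iff.1 hy).1, (mem_interior'_iff.1 hy).2, hz⟩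

/-- The lattice `ℤ^m` is connected. -/
theorem reflTransGen_adj (x y : Fin m → ℤ) : Relation.ReflTransGen Adj x y := by
  obtain ⟨n, hn⟩ : ∃ n : ℕ, ∀ k, |x k - y k| ≤ n := by
    refine ⟨∑ k, (x k - y k).natAbs, fun k => ?_⟩
    rw [Int.abs_eq_natAbs]
    exact_mod_cast Finset.single_le_sum (f := fun k => (x k - y k).natAbs)
      (fun _ _ => Nat.zero_le _) (Finset.mem_univ k)
  induction n generalizing x with
  | zero =>
    have : x = y := by
      funext k
      have := hn k
      rw [abs_le] at this
      omega
    exact this ▸ Relation.ReflTransGen.refl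
  | succ n ih =>
    let z : Fin m → ℤ := fun k => if x k < y k then x k + 1 else if y k < x k then x k - 1 else x k
    have hz : ∀ k, |x k - z k| ≤ 1 ∧ |z k - y k| ≤ n := by
      intro k
      have := hn k
      simp only [abs_le, z] at this ⊢
      push_cast at this
      split_ifs <;> omega
    have hzy := ih z fun k => (hz k).2
    by_cases hxz : x = z
    · exact hxz ▸ hzy
    · exact hzy.head ⟨hxz, fun k => (hz k).1⟩

/-- Every component of the complement of a nonempty set `M` is adjacent to `M`. -/
theorem exists_adj_component {M : Set (Fin m → ℤ)} (hM : M.Nonempty) {x : Fin m → ℤ}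
    (hx : x ∉ M) : ∃ c ∈ component Mᶜ x, ∃ p ∈ M, Adj c p := by
  obtain ⟨q, hq⟩ := hM
  by_contra! hno
  suffices h : ∀ y, Relation.ReflTransGen Adj x y → y ∈ component Mᶜ x from
    component_subset hx (h q (reflTransGen_adj x q)) hq
  intro y hy
  induction hy with
  | refl => exact mem_component_self _ x
  | tail _ hs ih =>
    exact Relation.ReflTransGen.tail ih
      ⟨hs, component_subset hx ih, fun hM => hno _ ih _ hM hs⟩

/-- A point not exceeded by `M` in some coordinate is not in the interior of `M`. -/
theorem notMem_interior'_of_forall_le {M : Set (Fin m → ℤ)} {x : Fin m → ℤ} (i : Fin m)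
    (hi : ∀ y ∈ M, y i ≤ x i) : x ∉ interior' M := by
  intro hx
  obtain ⟨hxM, hfin⟩ := mem_interior'_iff.1 hx
  have hray : ∀ n : ℕ, Function.update x i (x i + n) ∈ Mᶜ := by
    intro n hn
    rcases Nat.eq_zero_or_pos n with rfl | hpos
    · simp [hxM] at hn
    · have := hi _ hn
      simp only [Function.update_self] at this
      omega
  have hmem : ∀ n : ℕ, Function.update x i (x i + n) ∈ component Mᶜ x := by
    intro n
    induction n with
    | zero => simpa using mem_component_self Mᶜ x
    | succ n ih =>
      refine Relation.ReflTransGen.tail ih ⟨⟨fun h => ?_, fun k => ?_⟩, hray n, hray (n + 1)⟩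
      · have := congrFun h i
        simp at this
      · by_cases hk : k = i
        · subst hk
          simp
        · simp [hk]
  refine Set.infinite_of_injective_forall_mem (fun a b h => ?_) hmem hfin
  have := congrFun h i
  simpa using this

theorem ConnectedIn.subset_interior' {S M : Set (Fin m → ℤ)} (hS : ConnectedIn S)
    (hdisj : Disjoint S M) {x : Fin m → ℤ} (hxS : x ∈ S) (hx : x ∈ interior' M) :
    S ⊆ interior' M := fun _ hy =>
  component_subset_interior' hx (hS.mem_component hdisj.subset_compl_right hxS hy)

theorem interior'_subset_interior' {M N : Set (Fin m → ℤ)} (hM : M.Nonempty)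
    (hMN : M ⊆ interior' N) (hN : Disjoint N (interior' M)) : interior' M ⊆ interior' N := by
  intro y hy
  have hsub : component Mᶜ y ⊆ Nᶜ := fun z hz hzN =>
    hN.notMem_of_mem_left hzN (component_subset_interior' hy hz)
  obtain ⟨c, hc, p, hp, hcp⟩ := exists_adj_component hM (mem_interior'_iff.1 hy).1
  have hyp : p ∈ component Nᶜ y := Relation.ReflTransGen.tail
    (component_subset_component hsub hc) ⟨hcp, hsub hc, (mem_interior'_iff.1 (hMN hp)).1⟩
  exact component_subset_interior' (hMN hp) (mem_component_comm.1 hyp)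

theorem disjoint_interior' {M N : Set (Fin m → ℤ)} (hM : M.Nonempty) (hdisj : Disjoint M N)
    (hMN : Disjoint M (interior' N)) (hNM : Disjoint N (interior' M)) :
    Disjoint (interior' M) (interior' N) := by
  rw [Set.disjoint_left]
  intro y hyM hyN
  have hsub : component Mᶜ y ⊆ Nᶜ := fun z hz hzN =>
    hNM.notMem_of_mem_left hzN (component_subset_interior' hyM hz)
  obtain ⟨c, hc, p, hp, hcp⟩ := exists_adj_component hM (mem_interior'_iff.1 hyM).1
  have hyp : p ∈ component Nᶜ y := Relation.ReflTransGen.tail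
    (component_subset_component hsub hc) ⟨hcp, hsub hc, hdisj.notMem_of_mem_left hp⟩
  exact hMN.notMem_of_mem_left hp (component_subset_interior' hyN hyp)

theorem not_subset_interior'_and_subset_interior' {M N : Set (Fin m → ℤ)} (i : Fin m)
    (hMfin : M.Finite) (hNfin : N.Finite) (hM : M.Nonempty) (hN : N.Nonempty) :
    ¬ (M ⊆ interior' N ∧ N ⊆ interior' M) := by
  rintro ⟨hMN, hNM⟩
  obtain ⟨a, ha, hamax⟩ := Set.exists_max_image M (fun x => x i) hMfin hM
  obtain ⟨b, hb, hbmax⟩ := Set.exists_max_image N (fun x => x i) hNfin hN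
  rcases le_total (a i) (b i) with h | h
  · exact notMem_interior'_of_forall_le i (fun y hy => (hamax y hy).trans h) (hNM hb)
  · exact notMem_interior'_of_forall_le i (fun y hy => (hbmax y hy).trans h) (hMN ha)

theorem Distant.disjoint {K L : Set (Fin m → ℤ)} (h : Distant K L) : Disjoint K L := by
  rw [Set.disjoint_left]
  intro x hK hL
  obtain ⟨k, hk⟩ := h x hK x hL
  simp at hk

end

/-- Trichotomy for distant connected sets: if `M₁, M₂` are nonempty finite connected subsets
of `ℤ^m` with `d(M₁,M₂) > 1`, then either `M₂ ∪ Int M₂ ⊆ Int M₁`, or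
`M₁ ∪ Int M₁ ⊆ Int M₂`, or `M₁ ∪ Int M₁` and `M₂ ∪ Int M₂` are disjoint. -/
theorem distant_connected_sets_trichotomy (m : ℕ) (hm : 2 ≤ m)
    (M₁ M₂ : Set (Fin m → ℤ))
    (h₁fin : M₁.Finite) (h₂fin : M₂.Finite)
    (h₁ne : M₁.Nonempty) (h₂ne : M₂.Nonempty)
    (h₁conn : ConnectedIn M₁) (h₂conn : ConnectedIn M₂)
    (hdist : Distant M₁ M₂) :
    (M₂ ∪ interior' M₂ ⊆ interior' M₁) ∨
    (M₁ ∪ interior' M₁ ⊆ interior' M₂) ∨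
    Disjoint (M₁ ∪ interior' M₁) (M₂ ∪ interior' M₂) := by
  have hdisj := hdist.disjoint
  have h₁ : M₁ ⊆ interior' M₂ ∨ Disjoint M₁ (interior' M₂) := by
    refine or_iff_not_imp_right.2 fun h => ?_
    obtain ⟨x, hx, hx'⟩ := Set.not_disjoint_iff.1 h
    exact h₁conn.subset_interior' hdisj hx hx'
  have h₂ : M₂ ⊆ interior' M₁ ∨ Disjoint M₂ (interior' M₁) := by
    refine or_iff_not_imp_right.2 fun h => ?_
    obtain ⟨x, hx, hx'⟩ := Set.not_disjoint_iff.1 h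
    exact h₂conn.subset_interior' hdisj.symm hx hx'
  rcases h₁ with h₁ | h₁ <;> rcases h₂ with h₂ | h₂
  · exact absurd ⟨h₁, h₂⟩ (not_subset_interior'_and_subset_interior' ⟨0, by omega⟩
      h₁fin h₂fin h₁ne h₂ne)
  · exact Or.inr (Or.inl (Set.union_subset h₁ (interior'_subset_interior' h₁ne h₁ h₂)))
  · exact Or.inl (Set.union_subset h₂ (interior'_subset_interior' h₂ne h₂ h₁))
  · refine Or.inr (Or.inr ?_)
    rw [Set.disjoint_union_left, Set.disjoint_union_right, Set.disjoint_union_right]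
    exact ⟨⟨hdisj, h₁⟩, h₂.symm, disjoint_interior' h₁ne hdisj h₁ h₂⟩
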